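/- arXiv:2207.06929 — 2 statements merged into one kernel-verified Lean document; each statement's English description precedes it below -/
import Mathlib

section
/- If the center is helpless, then there is no protocol F = (F_1,…,F_N) in which the truthful profile (s^t,…,s^t) is the unique equilibrium. -/
open scoped Classical
noncomputable section

/-- A strategy of an agent: `(p, q)` with `p = P(mᵢ = 0 ∣ bᵢ = 0)`, `q = P(mᵢ = 0 ∣ bᵢ = 1)`. -/
abbrev Strategy : Type := (Set.Icc (0:ℝ) 1) × (Set.Icc (0:ℝ) 1)

/-- The truthful strategy `sᵗ = (1,0)`. -/
def sT : Strategy := (⟨1, by norm_num⟩, ⟨0, by norm_num⟩)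

/-- A zero-information strategy: `p = q`. -/
def ZeroInfo (s : Strategy) : Prop := (s.1 : ℝ) = (s.2 : ℝ)

/-- Vectors of `N+1` bits (bits of the center and the `N` agents; also used for
message vectors and for the center's replies).  Coordinate `0` is the center. -/
abbrev Bits (N : ℕ) : Type := Fin (N+1) → Bool

/-- A strategy profile of the `N` agents. -/
abbrev Profile (N : ℕ) : Type := Fin N → Strategy

/-- A protocol for a single agent: a map from strategy profiles and message vectors to
distributions over replies `f ∈ {0,1}^{N+1}`. -/
abbrev Protocol (N : ℕ) : Type := Profile N → Bits N → PMF (Bits N)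

/-- `P(message = msg ∣ bit = bit)` under strategy `s` (where `false` plays the role of `0`). -/
def strandP (s : Strategy) (bit msg : Bool) : ℝ :=
  if msg then 1 - (if bit then (s.2 : ℝ) else (s.1 : ℝ))
  else (if bit then (s.2 : ℝ) else (s.1 : ℝ))

/-- `P(messages = m ∣ bits = b)` under profile `s`; the center's message is her own bit. -/
def msgP {N : ℕ} (s : Profile N) (b m : Bits N) : ℝ :=
  (if m 0 = b 0 then (1:ℝ) else 0) * ∏ i : Fin N, strandP (s i) (b i.succ) (m i.succ)

/-- Joint probability of bits `b`, messages `m` and reply `f` (to the relevant agent),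
under profile `s` and protocol `F`; bits are i.i.d. uniform. -/
def jointP {N : ℕ} (s : Profile N) (F : Protocol N) (b m f : Bits N) : ℝ :=
  ((1:ℝ)/2)^(N+1) * msgP s b m * ((F s m) f).toReal

/-- `P(bᵢ = bi, mᵢ = mi, fᵢ = f, g(b) = val)` for agent `i` (coordinate `i.succ`). -/
def pObs {N : ℕ} (g : Bits N → Bool) (s : Profile N) (F : Protocol N) (i : Fin N)
    (bi mi : Bool) (f : Bits N) (val : Bool) : ℝ :=
  ∑ b : Bits N, ∑ m : Bits N,
    if b i.succ = bi ∧ m i.succ = mi ∧ g b = val then jointP s F b m f else 0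

/-- `P(bᵢ = bi, mᵢ = mi, fᵢ = f)` for agent `i`. -/
def pObsAll {N : ℕ} (s : Profile N) (F : Protocol N) (i : Fin N)
    (bi mi : Bool) (f : Bits N) : ℝ :=
  ∑ b : Bits N, ∑ m : Bits N,
    if b i.succ = bi ∧ m i.succ = mi then jointP s F b m f else 0

/-- `P(b_k = 1, bᵢ = bi, mᵢ = mi, fᵢ = f)` for agent `i`. -/
def pBit {N : ℕ} (s : Profile N) (F : Protocol N) (i : Fin N)
    (bi mi : Bool) (f : Bits N) (k : Fin (N+1)) : ℝ :=
  ∑ b : Bits N, ∑ m : Bits N,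
    if b i.succ = bi ∧ m i.succ = mi ∧ b k = true then jointP s F b m f else 0

/-- The posterior `v_k = P(b_k = 1 ∣ fᵢ, mᵢ, bᵢ)` of agent `i` at the realization
`(bi, mi, f)`. -/
def post {N : ℕ} (s : Profile N) (F : Protocol N) (i : Fin N)
    (bi mi : Bool) (f : Bits N) (k : Fin (N+1)) : ℝ :=
  pBit s F i bi mi f k / pObsAll s F i bi mi f

/-- Expected profit `V_i(s⃗; F_i)`: after observing `(bᵢ, mᵢ, fᵢ)` the agent guesses the
more likely value of `g(b)` (uniformly at random in case of a tie) and earns `c i` iff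
the guess is correct. -/
def V {N : ℕ} (g : Bits N → Bool) (c : Fin N → ℝ) (s : Profile N) (F : Protocol N)
    (i : Fin N) : ℝ :=
  c i * ∑ bi : Bool, ∑ mi : Bool, ∑ f : Bits N,
    (if pObs g s F i bi mi f true > pObs g s F i bi mi f false then pObs g s F i bi mi f true
     else if pObs g s F i bi mi f false > pObs g s F i bi mi f true then
       pObs g s F i bi mi f false
     else (pObs g s F i bi mi f false + pObs g s F i bi mi f true) / 2)

/-- Utility `U_i(s⃗; F_i) = V_i(s⃗; F_i) − priceᵢ(sᵢ)`. -/
def U {N : ℕ} (g : Bits N → Bool) (c : Fin N → ℝ) (price : Fin N → Strategy → ℝ)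
    (s : Profile N) (F : Protocol N) (i : Fin N) : ℝ :=
  V g c s F i - price i (s i)

/-- The all-truthful profile `(sᵗ, …, sᵗ)`. -/
def truthProfile (N : ℕ) : Profile N := fun _ => sT

/-- `s⃗` is an equilibrium of the protocol `F = (F_1,…,F_N)`. -/
def Equilibrium {N : ℕ} (g : Bits N → Bool) (c : Fin N → ℝ) (price : Fin N → Strategy → ℝ)
    (s : Profile N) (FF : Fin N → Protocol N) : Prop :=
  ∀ i : Fin N, ∀ s' : Strategy,
    U g c price s (FF i) i ≥ U g c price (Function.update s i s') (FF i) i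

/-- The improvement `F_i⁺` of a protocol `F_i`: it agrees with `F_i` when `s_i` is a
zero-information strategy, and otherwise returns the reply whose first coordinate is
`m₀ = b₀` and whose remaining coordinates are those of `F_i`'s reply. -/
def improve {N : ℕ} (i : Fin N) (F : Protocol N) : Protocol N := fun s m =>
  if ZeroInfo (s i) then F s m
  else PMF.map (fun f => Function.update f 0 (m 0)) (F s m)

/-- The center is helpless. -/
def Helpless (N : ℕ) (g : Bits N → Bool) (c : Fin N → ℝ)
    (price : Fin N → Strategy → ℝ) : Prop :=
  ∀ i : Fin N, ∀ F : Protocol N, ∀ si : Strategy, ¬ ZeroInfo si →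
    ∀ sr : Profile N, (∀ j, ZeroInfo (sr j)) →
      U g c price sr F i ≥ U g c price (Function.update sr i si) (improve i F) i

/-- Relative price `price_i^r(s_i) = price_i(s_i) / price_i(sᵗ)`. -/
def priceR {N : ℕ} (price : Fin N → Strategy → ℝ) (i : Fin N) (s : Strategy) : ℝ :=
  price i s / price i sT

/-- The competitive protocol (the component `F_i^c` for agent `i`). -/
def Fc {N : ℕ} (price : Fin N → Strategy → ℝ) (i : Fin N) : Protocol N := fun s m =>
  if ∀ j, s j = sT then PMF.pure m
  else if ∀ j, j ≠ i → priceR price j (s j) < priceR price i (s i) then PMF.pure m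
  else PMF.uniformOfFintype (Bits N)

/-- The protocol that always replies the full message vector `m = (b₀, m₁, …, m_N)`. -/
def Fmax (N : ℕ) : Protocol N := fun _ m => PMF.pure m

/-- The protocol that always replies `N+1` independent uniform random bits. -/
def Fmin (N : ℕ) : Protocol N := fun _ _ => PMF.uniformOfFintype (Bits N)

/-- Agent `i` is fanatic. -/
def Fanatic {N : ℕ} (g : Bits N → Bool) (c : Fin N → ℝ) (price : Fin N → Strategy → ℝ)
    (i : Fin N) : Prop :=
  ∀ s : Profile N,
    price i sT > V g c (truthProfile N) (Fmax N) i - V g c s (Fmin N) i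

/-- The fair competitive protocol (the component `F_i^{fc}` for agent `i`). -/
def Ffc {N : ℕ} (price : Fin N → Strategy → ℝ) (i : Fin N) : Protocol N := fun s m =>
  if s i = sT then PMF.pure m
  else if (∃ j, j ≠ i ∧ s j ≠ sT) ∧
      (∀ j, j ≠ i → s j ≠ sT → priceR price j (s j) < priceR price i (s i)) then PMF.pure m
  else PMF.uniformOfFintype (Bits N)

theorem sum_msgP {N : ℕ} (s : Profile N) (b : Bits N) : ∑ m : Bits N, msgP s b m = 1 := by
  let G : Fin (N + 1) → Bool → ℝ :=
    Fin.cons (fun x => if x = b 0 then 1 else 0) (fun i x => strandP (s i) (b i.succ) x)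
  have hG : ∀ m : Bits N, msgP s b m = ∏ k, G k (m k) := fun m => by
    simp [msgP, Fin.prod_univ_succ, G]
  have hsum : ∀ k, ∑ x, G k x = 1 := by
    intro k
    refine Fin.cases ?_ (fun i => ?_) k
    · simp [G]
    · simp [G, strandP]
  simp_rw [hG]
  rw [← Fintype.prod_sum]
  exact Finset.prod_eq_one fun k _ => hsum k

theorem strandP_nonneg (s : Strategy) (x y : Bool) : 0 ≤ strandP s x y := by
  have h1 := s.1.2.1
  have h2 := s.1.2.2
  have h3 := s.2.2.1
  have h4 := s.2.2.2
  cases x <;> cases y <;> simp [strandP] <;> assumption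

theorem msgP_nonneg {N : ℕ} (s : Profile N) (b m : Bits N) : 0 ≤ msgP s b m := by
  unfold msgP
  refine mul_nonneg (by split_ifs <;> norm_num) (Finset.prod_nonneg fun i _ => ?_)
  exact strandP_nonneg _ _ _

theorem strandP_eq_of_zeroInfo {s : Strategy} (h : ZeroInfo s) (x x' y : Bool) :
    strandP s x y = strandP s x' y := by
  unfold ZeroInfo at h
  cases x <;> cases x' <;> simp [strandP, h]

theorem msgP_congr {N : ℕ} {s : Profile N} {i : Fin N} (hs : ∀ j, j ≠ i → ZeroInfo (s j))
    {b b' : Bits N} (h0 : b 0 = b' 0) (hi : b i.succ = b' i.succ) (m : Bits N) :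
    msgP s b m = msgP s b' m := by
  unfold msgP
  rw [h0]
  congr 1
  refine Finset.prod_congr rfl fun j _ => ?_
  by_cases hj : j = i
  · subst hj
    rw [hi]
  · exact strandP_eq_of_zeroInfo (hs j hj) _ _ _

/-- A bit vector with own bit `bi` of agent `i` and center bit `b0`. -/
def twoBits {N : ℕ} (i : Fin N) (bi b0 : Bool) : Bits N :=
  Function.update (fun _ => b0) i.succ bi

/-- `P(bᵢ = bi, b₀ = b0, g(b) = v)`. -/
def priorP {N : ℕ} (g : Bits N → Bool) (i : Fin N) (bi b0 v : Bool) : ℝ :=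
  ∑ b : Bits N, if b i.succ = bi ∧ b 0 = b0 ∧ g b = v then ((1:ℝ)/2)^(N+1) else 0

/-- `P(mᵢ = mi, fᵢ = f ∣ bᵢ = bi, b₀ = b0)` when the other agents are zero-information. -/
def replyP {N : ℕ} (s : Profile N) (F : Protocol N) (i : Fin N) (bi b0 mi : Bool)
    (f : Bits N) : ℝ :=
  ∑ m : Bits N, if m i.succ = mi then msgP s (twoBits i bi b0) m * ((F s m) f).toReal else 0

/-- The expected profit of agent `i` when she knows exactly `bᵢ` and `b₀`. -/
def profitOfCenterBit {N : ℕ} (g : Bits N → Bool) (c : Fin N → ℝ) (i : Fin N) : ℝ :=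
  c i * ∑ bi, ∑ b0, max (priorP g i bi b0 true) (priorP g i bi b0 false)

theorem replyP_nonneg {N : ℕ} (s : Profile N) (F : Protocol N) (i : Fin N) (bi b0 mi : Bool)
    (f : Bits N) : 0 ≤ replyP s F i bi b0 mi f :=
  Finset.sum_nonneg fun m _ => by
    split_ifs
    · exact mul_nonneg (msgP_nonneg _ _ _) ENNReal.toReal_nonneg
    · exact le_rfl

theorem sum_pmf_toReal {α : Type*} [Fintype α] (p : PMF α) : ∑ a, (p a).toReal = 1 := by
  rw [← ENNReal.toReal_sum fun a _ => p.apply_ne_top a, ← tsum_fintype (L := .unconditional _),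
    p.tsum_coe, ENNReal.toReal_one]

theorem sum_replyP {N : ℕ} (s : Profile N) (F : Protocol N) (i : Fin N) (bi b0 : Bool) :
    ∑ mi, ∑ f, replyP s F i bi b0 mi f = 1 := by
  unfold replyP
  have h1 : ∀ mi : Bool, (∑ f, ∑ m : Bits N, if m i.succ = mi then
        msgP s (twoBits i bi b0) m * ((F s m) f).toReal else 0)
      = ∑ m : Bits N, if m i.succ = mi then msgP s (twoBits i bi b0) m else 0 := by
    intro mi
    rw [Finset.sum_comm]
    refine Finset.sum_congr rfl fun m _ => ?_
    split_ifs
    · rw [← Finset.mul_sum, sum_pmf_toReal, mul_one]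
    · simp
  simp_rw [h1]
  rw [Finset.sum_comm, ← sum_msgP s (twoBits i bi b0)]
  refine Finset.sum_congr rfl fun m _ => ?_
  simp

theorem pObs_eq_sum {N : ℕ} (g : Bits N → Bool) {s : Profile N} (F : Protocol N) {i : Fin N}
    (hs : ∀ j, j ≠ i → ZeroInfo (s j)) (bi mi : Bool) (f : Bits N) (v : Bool) :
    pObs g s F i bi mi f v = ∑ b0, priorP g i bi b0 v * replyP s F i bi b0 mi f := by
  unfold pObs priorP
  simp_rw [Finset.sum_mul]
  rw [Finset.sum_comm (s := (Finset.univ : Finset Bool))]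
  refine Finset.sum_congr rfl fun b _ => ?_
  rw [Finset.sum_eq_single (b 0) (fun b0 _ hb0 => by simp [hb0.symm]) (by simp)]
  by_cases hb : b i.succ = bi ∧ g b = v
  · obtain ⟨rfl, rfl⟩ := hb
    simp only [true_and, and_true, if_true, replyP, Finset.mul_sum]
    refine Finset.sum_congr rfl fun m _ => ?_
    rw [msgP_congr hs (b := twoBits i (b i.succ) (b 0)) (b' := b)
      (by simp [twoBits, (Fin.succ_ne_zero i).symm]) (by simp [twoBits])]
    split_ifs <;> simp [jointP, mul_assoc]
  · have h1 : ¬ (b i.succ = bi ∧ b 0 = b 0 ∧ g b = v) := fun h => hb ⟨h.1, h.2.2⟩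
    rw [if_neg h1, zero_mul]
    exact Finset.sum_eq_zero fun m _ => if_neg fun h => hb ⟨h.1, h.2.2⟩

theorem V_eq_sum_max {N : ℕ} (g : Bits N → Bool) (c : Fin N → ℝ) (s : Profile N)
    (F : Protocol N) (i : Fin N) :
    V g c s F i = c i * ∑ bi, ∑ mi, ∑ f,
      max (pObs g s F i bi mi f true) (pObs g s F i bi mi f false) := by
  unfold V
  congr 1
  refine Finset.sum_congr rfl fun bi _ => Finset.sum_congr rfl fun mi _ =>
    Finset.sum_congr rfl fun f _ => ?_
  split_ifs with h1 h2
  · exact (max_eq_left h1.le).symm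
  · exact (max_eq_right h2.le).symm
  · rw [le_antisymm (not_lt.mp h1) (not_lt.mp h2)]
    simp

theorem profitOfCenterBit_eq {N : ℕ} (g : Bits N → Bool) (c : Fin N → ℝ) (s : Profile N)
    (F : Protocol N) (i : Fin N) :
    profitOfCenterBit g c i = c i * ∑ bi, ∑ mi, ∑ f, ∑ b0,
      max (priorP g i bi b0 true) (priorP g i bi b0 false) * replyP s F i bi b0 mi f := by
  unfold profitOfCenterBit
  congr 1
  refine Finset.sum_congr rfl fun bi _ => ?_
  simp_rw [Finset.sum_comm (s := (Finset.univ : Finset (Bits N)))]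
  rw [Finset.sum_comm]
  refine Finset.sum_congr rfl fun b0 _ => ?_
  simp_rw [← Finset.mul_sum]
  rw [sum_replyP, mul_one]

theorem V_le_profitOfCenterBit {N : ℕ} (g : Bits N → Bool) {c : Fin N → ℝ} {s : Profile N}
    (F : Protocol N) {i : Fin N} (hc : 0 < c i) (hs : ∀ j, j ≠ i → ZeroInfo (s j)) :
    V g c s F i ≤ profitOfCenterBit g c i := by
  rw [V_eq_sum_max, profitOfCenterBit_eq g c s F i]
  refine mul_le_mul_of_nonneg_left ?_ hc.le
  refine Finset.sum_le_sum fun bi _ => Finset.sum_le_sum fun mi _ =>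
    Finset.sum_le_sum fun f _ => ?_
  rw [pObs_eq_sum g F hs, pObs_eq_sum g F hs]
  refine max_le ?_ ?_ <;> refine Finset.sum_le_sum fun b0 _ => ?_
  · exact mul_le_mul_of_nonneg_right (le_max_left _ _) (replyP_nonneg _ _ _ _ _ _ _)
  · exact mul_le_mul_of_nonneg_right (le_max_right _ _) (replyP_nonneg _ _ _ _ _ _ _)

theorem replyP_improve_eq_zero {N : ℕ} {s : Profile N} (F : Protocol N) {i : Fin N}
    (hi : ¬ ZeroInfo (s i)) (bi mi : Bool) {b0 : Bool} {f : Bits N} (hf : f 0 ≠ b0) :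
    replyP s (improve i F) i bi b0 mi f = 0 := by
  refine Finset.sum_eq_zero fun m _ => ?_
  split_ifs
  · by_cases hm : m 0 = b0
    · have h : (improve i F s m) f = 0 := by
        rw [improve, if_neg hi, PMF.apply_eq_zero_iff, PMF.mem_support_map_iff]
        rintro ⟨f', -, rfl⟩
        exact hf (by simp [hm])
      simp [h]
    · simp [msgP, twoBits, (Fin.succ_ne_zero i).symm, hm]
  · rfl

theorem V_improve {N : ℕ} (g : Bits N → Bool) (c : Fin N → ℝ) {s : Profile N}
    (F : Protocol N) {i : Fin N} (hi : ¬ ZeroInfo (s i)) (hs : ∀ j, j ≠ i → ZeroInfo (s j)) :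
    V g c s (improve i F) i = profitOfCenterBit g c i := by
  rw [V_eq_sum_max, profitOfCenterBit_eq g c s (improve i F) i]
  congr 1
  refine Finset.sum_congr rfl fun bi _ => Finset.sum_congr rfl fun mi _ =>
    Finset.sum_congr rfl fun f _ => ?_
  have hsingle : ∀ A : Bool → ℝ, ∑ b0, A b0 * replyP s (improve i F) i bi b0 mi f
      = A (f 0) * replyP s (improve i F) i bi (f 0) mi f := fun A =>
    Finset.sum_eq_single (f 0)
      (fun b0 _ hb => by rw [replyP_improve_eq_zero F hi bi mi hb.symm, mul_zero]) (by simp)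
  rw [pObs_eq_sum g _ hs, pObs_eq_sum g _ hs, hsingle, hsingle,
    hsingle (fun b0 => max (priorP g i bi b0 true) (priorP g i bi b0 false)),
    max_mul_of_nonneg _ _ (replyP_nonneg _ _ _ _ _ _ _)]

theorem exists_not_zeroInfo_lt {p : Strategy → ℝ} (hp : Continuous p)
    (h0 : ∀ s, ZeroInfo s → p s = 0) {ε : ℝ} (hε : 0 < ε) :
    ∃ s, ¬ ZeroInfo s ∧ p s < ε := by
  let γ : ℝ → Strategy := fun x => (Set.projIcc 0 1 zero_le_one x, 0)
  have hγ : Continuous γ := by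
    have := continuous_projIcc (a := (0:ℝ)) (b := 1) (h := zero_le_one)
    fun_prop
  have hlim : ∀ᶠ x in nhdsWithin (0:ℝ) (Set.Ioi 0), p (γ x) < ε := by
    refine nhdsWithin_le_nhds ((hp.comp hγ).continuousAt.eventually_lt
      (continuousAt_const (y := ε)) ?_)
    have : p (γ 0) = 0 := h0 _ (by simp [γ, ZeroInfo])
    simpa [this] using hε
  obtain ⟨x, hx, hx0, hx1⟩ :=
    (hlim.and (Ioo_mem_nhdsGT (zero_lt_one' ℝ))).exists
  refine ⟨γ x, ?_, hx⟩
  have : ((γ x).1 : ℝ) = x := by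
    simp [γ, Set.projIcc_of_mem zero_le_one ⟨hx0.le, hx1.le⟩]
  unfold ZeroInfo
  rw [this]
  simpa [γ] using hx0.ne'

theorem Helpless.equilibrium_of_zeroInfo {N : ℕ} {g : Bits N → Bool} {c : Fin N → ℝ}
    (hc : ∀ i, 0 < c i) {price : Fin N → Strategy → ℝ}
    (hpriceCont : ∀ i, Continuous (price i))
    (hprice0 : ∀ i s, ZeroInfo s → price i s = 0)
    (hpricePos : ∀ i s, ¬ ZeroInfo s → 0 < price i s)
    (h : Helpless N g c price) (FF : Fin N → Protocol N) {s : Profile N}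
    (hs : ∀ j, ZeroInfo (s j)) : Equilibrium g c price s FF := by
  intro i s'
  have hothers : ∀ t j, j ≠ i → ZeroInfo (Function.update s i t j) := fun t j hj => by
    rw [Function.update_of_ne hj]
    exact hs j
  have hlow : profitOfCenterBit g c i ≤ U g c price s (FF i) i := by
    refine le_of_forall_pos_lt_add fun ε hε => ?_
    obtain ⟨t, ht, htε⟩ := exists_not_zeroInfo_lt (hpriceCont i) (hprice0 i) hε
    have hU := h i (FF i) t ht s hs
    have hV := V_improve g c (s := Function.update s i t) (FF i) (by simpa using ht) (hothers t)
    rw [U.eq_1 g c price (Function.update s i t), hV, Function.update_self] at hU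
    linarith
  have hprice : 0 ≤ price i s' := by
    by_cases hz : ZeroInfo s'
    · exact (hprice0 i s' hz).ge
    · exact (hpricePos i s' hz).le
  have hup := V_le_profitOfCenterBit g (FF i) (hc i) (hothers s')
  rw [U.eq_1 g c price (Function.update s i s'), Function.update_self]
  linarith

/-- helpless center: no protocol with truthfulness as unique equilibrium. -/
theorem helpless_no_unique_truthful (N : ℕ) (hN : 2 ≤ N) (g : Bits N → Bool) (c : Fin N → ℝ)
    (hc : ∀ i, 0 < c i)
    (price : Fin N → Strategy → ℝ)
    (hpriceCont : ∀ i, Continuous (price i))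
    (hprice0 : ∀ i s, ZeroInfo s → price i s = 0)
    (hpricePos : ∀ i s, ¬ ZeroInfo s → 0 < price i s)
    (hpriceMax : ∀ i s, price i s ≤ price i sT)
    (h : Helpless N g c price) :
    ¬ ∃ FF : Fin N → Protocol N,
        Equilibrium g c price (truthProfile N) FF ∧
        ∀ s : Profile N, Equilibrium g c price s FF → s = truthProfile N := by
  rintro ⟨FF, -, huniq⟩
  have heq := huniq (fun _ => (0, 0)) (h.equilibrium_of_zeroInfo hc hpriceCont hprice0 hpricePos
    FF fun _ => rfl)
  have h1 := congrArg (fun s : Strategy => (s.1 : ℝ)) (congrFun heq ⟨0, by lia⟩)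
  simp [truthProfile, sT] at h1

end
end

section
/- In the competitive protocol F^c, for every agent i ∈ {1,…,N}, every zero-information strategy s_i^r ∈ S^r, and every strategy s_i ∉ S^r with s_i ≠ s^t, when all other agents play truthfully we have U_i(s_i^r, (s^t,…,s^t); F_i^c) > U_i(s_i, (s^t,…,s^t); F_i^c). -/
open scoped Classical
noncomputable section

theorem sum_strandP (s : Strategy) (x : Bool) : ∑ y : Bool, strandP s x y = 1 := by
  simp [strandP]

/-- The marginal law of agent `i`'s message, given the bits. -/
theorem sum_msgP_eq_strandP {N : ℕ} (s : Profile N) (b : Bits N) (i : Fin N) (y : Bool) :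
    ∑ m : Bits N, (if m i.succ = y then msgP s b m else 0) = strandP (s i) (b i.succ) y := by
  let h : Fin (N + 1) → Bool → ℝ :=
    Fin.cons (fun x => if x = b 0 then 1 else 0)
      (fun k x => strandP (s k) (b k.succ) x * if k = i then (if x = y then 1 else 0) else 1)
  have hm (m : Bits N) : (if m i.succ = y then msgP s b m else 0) = ∏ k, h k (m k) := by
    rw [Fin.prod_univ_succ]
    simp only [h, Fin.cons_zero, Fin.cons_succ, Finset.prod_mul_distrib, Finset.prod_ite_eq',
      Finset.mem_univ, if_true, msgP]
    split_ifs <;> simp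
  have hk (k : Fin N) :
      ∑ x, h k.succ x = if k = i then strandP (s i) (b i.succ) y else 1 := by
    simp only [h, Fin.cons_succ]
    split_ifs with hki
    · subst hki
      simp
    · simpa using sum_strandP (s k) (b k.succ)
  have h0 : ∑ x, h 0 x = 1 := by simp [h]
  calc ∑ m : Bits N, (if m i.succ = y then msgP s b m else 0)
      = ∑ m : Bits N, ∏ k, h k (m k) := Finset.sum_congr rfl fun m _ => hm m
    _ = ∏ k, ∑ x, h k x := (Fintype.prod_sum h).symm
    _ = strandP (s i) (b i.succ) y := by
      rw [Fin.prod_univ_succ, h0, one_mul]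
      simp only [hk, Finset.prod_ite_eq', Finset.mem_univ, if_true]

/-- Against a constant reply distribution, the observation probabilities factor through the
law of the agent's own message. -/
theorem pObs_of_const {N : ℕ} (g : Bits N → Bool) (s : Profile N) (F : Protocol N) (i : Fin N)
    (P : PMF (Bits N)) (hF : ∀ m, F s m = P) (x y : Bool) (f : Bits N) (v : Bool) :
    pObs g s F i x y f v = strandP (s i) x y *
      ∑ b : Bits N, if b i.succ = x ∧ g b = v then ((1 : ℝ) / 2) ^ (N + 1) * (P f).toReal
        else 0 := by
  unfold pObs
  rw [Finset.mul_sum]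
  refine Finset.sum_congr rfl fun b _ => ?_
  by_cases hb : b i.succ = x ∧ g b = v
  · obtain ⟨rfl, rfl⟩ := hb
    simp only [true_and, and_true, and_self, if_true, jointP, hF]
    rw [← sum_msgP_eq_strandP s b i y, Finset.sum_mul]
    refine Finset.sum_congr rfl fun m _ => ?_
    split_ifs <;> ring
  · rw [if_neg hb, mul_zero]
    exact Finset.sum_eq_zero fun m _ => if_neg fun h => hb ⟨h.1, h.2.2⟩

theorem guess_eq_max (a b : ℝ) :
    (if a > b then a else if b > a then b else (b + a) / 2) = max a b := by
  split_ifs with h₁ h₂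
  · exact (max_eq_left h₁.le).symm
  · exact (max_eq_right h₂.le).symm
  · obtain rfl : a = b := le_antisymm (not_lt.1 h₁) (not_lt.1 h₂)
    simp

/-- Against a constant reply distribution, the expected profit does not depend on the strategies. -/
theorem V_of_const {N : ℕ} (g : Bits N → Bool) (c : Fin N → ℝ) (s : Profile N) (F : Protocol N)
    (i : Fin N) (P : PMF (Bits N)) (hF : ∀ m, F s m = P) :
    V g c s F i = c i * ∑ x : Bool, ∑ f : Bits N,
      max (∑ b : Bits N, if b i.succ = x ∧ g b = true then
          ((1 : ℝ) / 2) ^ (N + 1) * (P f).toReal else 0)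
        (∑ b : Bits N, if b i.succ = x ∧ g b = false then
          ((1 : ℝ) / 2) ^ (N + 1) * (P f).toReal else 0) := by
  simp only [V, guess_eq_max, pObs_of_const g s F i P hF]
  simp only [← mul_max_of_nonneg _ _ (strandP_nonneg _ _ _), ← Finset.mul_sum, ← Finset.sum_mul,
    sum_strandP, one_mul]

theorem Fc_update_truthProfile {N : ℕ} (hN : 2 ≤ N) (price : Fin N → Strategy → ℝ)
    (hpos : ∀ i, 0 < price i sT) (hmax : ∀ i s, price i s ≤ price i sT) (i : Fin N)
    (s : Strategy) (hs : s ≠ sT) (m : Bits N) :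
    Fc price i (Function.update (truthProfile N) i s) m = PMF.uniformOfFintype (Bits N) := by
  have : Nontrivial (Fin N) := Fin.nontrivial_iff_two_le.2 hN
  obtain ⟨j, hj⟩ := exists_ne i
  unfold Fc
  rw [if_neg fun h => hs (by simpa using h i), if_neg]
  intro h
  have hlt := h j hj
  rw [Function.update_self, Function.update_of_ne hj, truthProfile, priceR, priceR,
    div_self (hpos j).ne', one_lt_div (hpos i)] at hlt
  exact absurd (hmax i s) (not_le.2 hlt)

theorem not_zeroInfo_sT : ¬ ZeroInfo sT := by
  simp [ZeroInfo, sT]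

/-- deviation to zero-information beats any other non-truthful deviation
when all others are truthful, in the competitive protocol. -/
theorem zeroinfo_deviation_best (N : ℕ) (hN : 2 ≤ N) (g : Bits N → Bool) (c : Fin N → ℝ)
    (hc : ∀ i, 0 < c i)
    (price : Fin N → Strategy → ℝ)
    (hpriceCont : ∀ i, Continuous (price i))
    (hprice0 : ∀ i s, ZeroInfo s → price i s = 0)
    (hpricePos : ∀ i s, ¬ ZeroInfo s → 0 < price i s)
    (hpriceMax : ∀ i s, price i s ≤ price i sT)
    (i : Fin N) (sir : Strategy) (hsir : ZeroInfo sir)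
    (si : Strategy) (hsi : ¬ ZeroInfo si) (hne : si ≠ sT) :
    U g c price (Function.update (truthProfile N) i sir) (Fc price i) i >
      U g c price (Function.update (truthProfile N) i si) (Fc price i) i := by
  have hT : ∀ j, 0 < price j sT := fun j => hpricePos j sT not_zeroInfo_sT
  have hr : sir ≠ sT := fun h => not_zeroInfo_sT (h ▸ hsir)
  unfold U
  rw [V_of_const g c _ _ i _ (Fc_update_truthProfile hN price hT hpriceMax i sir hr),
    V_of_const g c _ _ i _ (Fc_update_truthProfile hN price hT hpriceMax i si hne),
    Function.update_self, Function.update_self, hprice0 i sir hsir]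
  linarith [hpricePos i si hsi]

end
end
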